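/- For every partition λ and every integer k, the number of nodes (i, j) with i ≥ 1, 1 ≤ j ≤ λ_i and j − i = k equals #{i ∈ ℤ : i ≤ k and p_λ(i) = 1} − #{i ∈ ℤ : 1 ≤ i ≤ k}; that is, the multiplicity of the content k in the diagram of λ is recovered from the partial sums of the path sequence of λ minus the partial sums of the path sequence of the empty partition. -/

import Mathlib

/-- A partition: a non-increasing sequence of non-negative integers with finite sum.
Here `part i` is the `(i+1)`-st part `λ_{i+1}`. -/
structure PartitionSeq : Type where
  part : ℕ → ℕ
  antitone' : ∀ {i j : ℕ}, i ≤ j → part j ≤ part i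
  eventually_zero : ∃ N : ℕ, ∀ i : ℕ, N ≤ i → part i = 0

/-- The size `|λ| = Σ_i λ_i` of a partition. -/
noncomputable def PartitionSeq.size (μ : PartitionSeq) : ℕ := ∑ᶠ i : ℕ, μ.part i

open scoped Classical in
/-- The path sequence (Maya diagram) of a partition: `p_λ(i) = 0` if
`i = λ_j - j + 1` for some `j ≥ 1` (i.e. `i = part j - j` for some `j : ℕ` in the
0-indexed convention used here), and `p_λ(i) = 1` otherwise. -/
noncomputable def PartitionSeq.path (μ : PartitionSeq) (i : ℤ) : ℕ :=
  if ∃ j : ℕ, i = (μ.part j : ℤ) - (j : ℤ) then 0 else 1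

section PathCounts

variable (μ₁ μ₂ : PartitionSeq) (f : ℕ)

/-- Predicate: position `i` of the `f`-shifted path sequence of the bipartition
`(μ₁, μ₂)` carries the pair `A = (0,1)`. -/
def pairA (i : ℤ) : Prop := μ₁.path i = 0 ∧ μ₂.path (i - f) = 1

/-- Pair `B = (1,0)` at position `i`. -/
def pairB (i : ℤ) : Prop := μ₁.path i = 1 ∧ μ₂.path (i - f) = 0

/-- Pair `C = (0,0)` at position `i`. -/
def pairC (i : ℤ) : Prop := μ₁.path i = 0 ∧ μ₂.path (i - f) = 0

/-- Pair `D = (1,1)` at position `i`. -/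
def pairD (i : ℤ) : Prop := μ₁.path i = 1 ∧ μ₂.path (i - f) = 1

/-- The number of positions `i ≤ 0` (the left region) where `P` holds. -/
noncomputable def countL (P : ℤ → Prop) : ℕ := Set.ncard {i : ℤ | i ≤ 0 ∧ P i}

/-- The number of positions `1 ≤ i ≤ f` (the middle region) where `P` holds. -/
noncomputable def countM (P : ℤ → Prop) : ℕ :=
  Set.ncard {i : ℤ | 1 ≤ i ∧ i ≤ (f : ℤ) ∧ P i}

/-- The number of positions `i > f` (the right region) where `P` holds. -/
noncomputable def countR (P : ℤ → Prop) : ℕ := Set.ncard {i : ℤ | (f : ℤ) < i ∧ P i}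

end PathCounts

namespace PartitionSeq

theorem path_eq_one_iff (μ : PartitionSeq) (i : ℤ) :
    μ.path i = 1 ↔ ∀ j : ℕ, i ≠ (μ.part j : ℤ) - j := by
  unfold path
  split_ifs with h
  · simpa using h
  · simpa using h

theorem injective_part_sub (μ : PartitionSeq) :
    Function.Injective fun j : ℕ => (μ.part j : ℤ) - j := by
  refine StrictAnti.injective fun i j hij => ?_
  have := μ.antitone' hij.le
  omega

/-- If `N` is at least the length of `μ` and `-k`, then the ones of the path at positions `≤ k`
are counted by `k` and the number of zeros to the right of `k`. -/
theorem ncard_path_eq_one (μ : PartitionSeq) {k : ℤ} {N : ℕ}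
    (hN : ∀ i : ℕ, N ≤ i → μ.part i = 0) (hk : -k ≤ N) :
    (Set.ncard {i : ℤ | i ≤ k ∧ μ.path i = 1} : ℤ) =
      k + ((Finset.range N).filter fun j : ℕ => k < (μ.part j : ℤ) - j).card := by
  set Z := ((Finset.range N).filter fun j : ℕ => ¬ k < (μ.part j : ℤ) - j).image
    fun j : ℕ => (μ.part j : ℤ) - j with hZ
  have hset : {i : ℤ | i ≤ k ∧ μ.path i = 1} = ↑(Finset.Ioc (-(N : ℤ)) k \ Z) := by
    ext i
    simp only [Set.mem_ofPred_eq, path_eq_one_iff, Finset.coe_sdiff, Set.mem_sdiff, Finset.mem_coe,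
      Finset.mem_Ioc, hZ, Finset.mem_image, Finset.mem_filter, Finset.mem_range, not_exists,
      not_and]
    constructor
    · rintro ⟨hi, h⟩
      refine ⟨⟨?_, hi⟩, fun j _ hj => h j hj.symm⟩
      by_contra hc
      have h0 := hN (-i).toNat (by omega)
      exact h (-i).toNat (by omega)
    · rintro ⟨⟨hlo, hi⟩, h⟩
      refine ⟨hi, fun j hj => ?_⟩
      have hjN : j < N := by
        by_contra hc
        have := hN j (by omega)
        omega
      exact h j ⟨hjN, by omega⟩ hj.symm
  have hsub : Z ⊆ Finset.Ioc (-(N : ℤ)) k := by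
    intro i
    simp only [hZ, Finset.mem_image, Finset.mem_filter, Finset.mem_range, Finset.mem_Ioc]
    rintro ⟨j, hj, rfl⟩
    omega
  have hcard := Finset.card_sdiff_add_card_eq_card hsub
  have hsplit := Finset.card_filter_add_card_filter_not (s := Finset.range N)
    (fun j : ℕ => k < (μ.part j : ℤ) - j)
  rw [hset, Set.ncard_coe_finset]
  have hZcard := Finset.card_image_of_injective
    ((Finset.range N).filter fun j : ℕ => ¬ k < (μ.part j : ℤ) - j) μ.injective_part_sub
  rw [← hZ] at hZcard
  rw [Int.card_Ioc] at hcard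
  rw [Finset.card_range] at hsplit
  omega

/-- The nodes of content `k` correspond to the zeros of the path to the right of `k`, except for
those coming from the first `-k` rows. -/
theorem ncard_content (μ : PartitionSeq) {k : ℤ} {N : ℕ}
    (hN : ∀ i : ℕ, N ≤ i → μ.part i = 0) (hk : -k ≤ N) :
    Set.ncard {x : ℕ × ℕ |
        1 ≤ x.1 ∧ 1 ≤ x.2 ∧ x.2 ≤ μ.part (x.1 - 1) ∧ (x.2 : ℤ) - (x.1 : ℤ) = k} + (-k).toNat =
      ((Finset.range N).filter fun j : ℕ => k < (μ.part j : ℤ) - j).card := by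
  set F := (Finset.range N).filter fun j : ℕ => k < (μ.part j : ℤ) - j with hF
  have hset : {x : ℕ × ℕ |
      1 ≤ x.1 ∧ 1 ≤ x.2 ∧ x.2 ≤ μ.part (x.1 - 1) ∧ (x.2 : ℤ) - (x.1 : ℤ) = k} =
      ↑((F \ Finset.range (-k).toNat).image fun j : ℕ => (j + 1, (k + j + 1).toNat)) := by
    ext ⟨r, c⟩
    simp only [Set.mem_ofPred_eq, Finset.coe_image, Set.mem_image, Finset.mem_coe,
      Finset.mem_sdiff, hF, Finset.mem_filter, Finset.mem_range, Prod.mk.injEq]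
    constructor
    · rintro ⟨hr, hc, hle, heq⟩
      have hrN : r - 1 < N := by
        by_contra hcon
        have := hN (r - 1) (by omega)
        omega
      exact ⟨r - 1, ⟨⟨hrN, by omega⟩, by omega⟩, by omega, by omega⟩
    · rintro ⟨j, ⟨⟨hjN, hj⟩, hjk⟩, rfl, rfl⟩
      rw [Nat.add_sub_cancel]
      omega
  have hinj : Function.Injective fun j : ℕ => (j + 1, (k + j + 1).toNat) := by
    intro i j h
    simpa using congrArg Prod.fst h
  have hsub : Finset.range (-k).toNat ⊆ F := by
    intro j
    simp only [hF, Finset.mem_filter, Finset.mem_range]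
    omega
  have hcard := Finset.card_sdiff_add_card_eq_card hsub
  rw [Finset.card_range] at hcard
  rw [hset, Set.ncard_coe_finset, Finset.card_image_of_injective _ hinj, hcard]

end PartitionSeq

theorem content_multiplicity_eq_path_partial_sums (μ : PartitionSeq) (k : ℤ) :
    (Set.ncard {x : ℕ × ℕ |
        1 ≤ x.1 ∧ 1 ≤ x.2 ∧ x.2 ≤ μ.part (x.1 - 1) ∧ (x.2 : ℤ) - (x.1 : ℤ) = k} : ℤ) =
      (Set.ncard {i : ℤ | i ≤ k ∧ μ.path i = 1} : ℤ) -
        (Set.ncard {i : ℤ | 1 ≤ i ∧ i ≤ k} : ℤ) := by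
  obtain ⟨N, hN⟩ := μ.eventually_zero
  have hN' : ∀ i : ℕ, N + (-k).toNat ≤ i → μ.part i = 0 := fun i hi => hN i (by omega)
  have hk : -k ≤ ((N + (-k).toNat : ℕ) : ℤ) := by omega
  have hIcc : Set.ncard {i : ℤ | 1 ≤ i ∧ i ≤ k} = k.toNat := by
    have h : {i : ℤ | 1 ≤ i ∧ i ≤ k} = ↑(Finset.Icc 1 k) := by
      ext i
      simp
    rw [h, Set.ncard_coe_finset, Int.card_Icc, add_sub_cancel_right]
  rw [μ.ncard_path_eq_one hN' hk, ← μ.ncard_content hN' hk, hIcc]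
  omega
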